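/- arXiv:2008.05508 — 2 statements merged into one kernel-verified Lean document; each statement's English description precedes it below -/
import Mathlib

section
/- Let s > 0. There exists C > 0 such that for every measurable f : ℝ → ℂ with N_{s+1}(f) < ∞, one has sup_{ξ > 1} ∫∫_{{(ξ₁,ξ₂) ∈ ℝ² : ξ₁ > ξ}} |ξ₂ + ξ₃| · |ξ₃| · |f(ξ₁)| |f(ξ₂)| |f(ξ₃)| dξ₁ dξ₂ ≤ C N_{s+1}(f)³, where ξ₃ = ξ − ξ₁ − ξ₂. Consequently, the Fourier transform of the cubic nonlinearity C₊(V) of the gauged Benjamin–Ono equation is uniformly bounded in frequency by C‖V‖³_{H^{s+1}} when f is the Fourier transform of V. -/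
open MeasureTheory Real
open scoped ENNReal

/-- Japanese bracket `⟨ξ⟩ = (1+ξ²)^{1/2}`. -/
noncomputable def jap (ξ : ℝ) : ℝ := Real.sqrt (1 + ξ ^ 2)

/-- Frequency-side Sobolev norm `N_σ(f) = (∫ ⟨ξ⟩^{2σ} |f(ξ)|² dξ)^{1/2}`,
valued in `ℝ≥0∞`. -/
noncomputable def sobNorm (σ : ℝ) (f : ℝ → ℂ) : ℝ≥0∞ :=
  (∫⁻ ξ : ℝ, ENNReal.ofReal (jap ξ ^ (2 * σ)) * (‖f ξ‖₊ : ℝ≥0∞) ^ 2) ^ (1 / 2 : ℝ)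

lemma one_le_jap (x : ℝ) : 1 ≤ jap x :=
  Real.one_le_sqrt.mpr (by nlinarith [sq_nonneg x])

lemma abs_le_jap (x : ℝ) : |x| ≤ jap x :=
  Real.abs_le_sqrt (by linarith)

lemma abs_le_jap_rpow {r : ℝ} (hr : 1 ≤ r) (x : ℝ) : |x| ≤ jap x ^ r :=
  (abs_le_jap x).trans (Real.self_le_rpow_of_one_le (one_le_jap x) hr)

@[fun_prop]
lemma measurable_jap : Measurable jap := by
  unfold jap
  fun_prop

/-- The function `⟨ξ⟩^σ |f(ξ)|`, whose `L²` norm is `N_σ(f)`. -/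
noncomputable def sobWeighted (σ : ℝ) (f : ℝ → ℂ) (x : ℝ) : ℝ≥0∞ :=
  ENNReal.ofReal (jap x ^ σ * ‖f x‖)

lemma measurable_sobWeighted (σ : ℝ) {f : ℝ → ℂ} (hf : Measurable f) :
    Measurable (sobWeighted σ f) := by
  unfold sobWeighted
  fun_prop

lemma sobNorm_eq_sobWeighted (σ : ℝ) (f : ℝ → ℂ) :
    sobNorm σ f = (∫⁻ x, sobWeighted σ f x ^ (2 : ℝ)) ^ (1 / 2 : ℝ) := by
  unfold sobNorm sobWeighted
  congr 1
  refine lintegral_congr fun x => ?_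
  have h0 : 0 ≤ jap x := zero_le_one.trans (one_le_jap x)
  rw [ENNReal.rpow_two, ENNReal.ofReal_mul (by positivity), mul_pow,
    ← ENNReal.ofReal_pow (by positivity), ← Real.rpow_mul_natCast h0, ofReal_norm,
    Nat.cast_ofNat, mul_comm σ 2]
  rfl

lemma lintegral_jap_rpow_lt_top {r : ℝ} (hr : 1 < r) :
    ∫⁻ x : ℝ, ENNReal.ofReal (jap x ^ (-r)) < ⊤ := by
  have h := integrable_rpow_neg_one_add_norm_sq (E := ℝ) (μ := volume) (r := r) (by simpa using hr)
  refine lt_of_le_of_lt (lintegral_mono fun x => ?_) h.lintegral_lt_top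
  refine ENNReal.ofReal_le_ofReal (le_of_eq ?_)
  rw [jap, Real.sqrt_eq_rpow, ← Real.rpow_mul (by positivity), Real.norm_eq_abs, sq_abs]
  congr 1
  ring

lemma lintegral_mul_le_sqrt_mul_sqrt {u v : ℝ → ℝ≥0∞} (hu : Measurable u) (hv : Measurable v) :
    ∫⁻ x, u x * v x ≤
      (∫⁻ x, u x ^ (2 : ℝ)) ^ (1 / 2 : ℝ) * (∫⁻ x, v x ^ (2 : ℝ)) ^ (1 / 2 : ℝ) :=
  ENNReal.lintegral_mul_le_Lp_mul_Lq volume Real.HolderConjugate.two_two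
    hu.aemeasurable hv.aemeasurable

/-- Cauchy–Schwarz bound of `L¹` by a Sobolev norm. -/
lemma lintegral_norm_le_sobNorm (σ : ℝ) {f : ℝ → ℂ} (hf : Measurable f) :
    ∫⁻ x, ENNReal.ofReal ‖f x‖ ≤
      (∫⁻ x : ℝ, ENNReal.ofReal (jap x ^ (-(2 * σ)))) ^ (1 / 2 : ℝ) * sobNorm σ f := by
  have hw : Measurable fun x : ℝ => ENNReal.ofReal (jap x ^ (-σ)) := by fun_prop
  have h := lintegral_mul_le_sqrt_mul_sqrt hw (measurable_sobWeighted σ hf)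
  rw [← sobNorm_eq_sobWeighted] at h
  convert h using 4 with x
  · have h0 : 0 < jap x := zero_lt_one.trans_le (one_le_jap x)
    rw [sobWeighted, ← ENNReal.ofReal_mul (by positivity), ← mul_assoc, ← Real.rpow_add h0,
      neg_add_cancel, Real.rpow_zero, one_mul]
  · funext x
    have h0 : 0 < jap x := zero_lt_one.trans_le (one_le_jap x)
    rw [ENNReal.rpow_two, ← ENNReal.ofReal_pow (by positivity), ← Real.rpow_mul_natCast h0.le]
    congr 2
    push_cast
    ring

/-- Young-type bound of a triple convolution by `L² × L¹ × L²`. -/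
lemma lintegral_triple_convolution_le {u v : ℝ → ℝ≥0∞} (hu : Measurable u) (hv : Measurable v)
    (ξ : ℝ) :
    ∫⁻ x, ∫⁻ y, u x * v y * u (ξ - x - y) ≤
      (∫⁻ y, v y) * ((∫⁻ x, u x ^ (2 : ℝ)) ^ (1 / 2 : ℝ)) ^ 2 := by
  rw [lintegral_lintegral_swap (by fun_prop), ← lintegral_mul_const _ hv]
  refine lintegral_mono fun y => ?_
  have hrefl : ∫⁻ x, u (ξ - x - y) ^ (2 : ℝ) = ∫⁻ x, u x ^ (2 : ℝ) := by
    rw [← lintegral_sub_left_eq_self (fun x => u x ^ (2 : ℝ)) (ξ - y)]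
    simp only [sub_right_comm]
  have h := lintegral_mul_le_sqrt_mul_sqrt hu (v := fun x => u (ξ - x - y)) (by fun_prop)
  rw [hrefl, ← sq] at h
  calc ∫⁻ x, u x * v y * u (ξ - x - y)
      = ∫⁻ x, v y * (u x * u (ξ - x - y)) := lintegral_congr fun x => by ring
    _ = v y * ∫⁻ x, u x * u (ξ - x - y) := lintegral_const_mul _ (by fun_prop)
    _ ≤ _ := by gcongr

lemma cubic_integrand_le {σ : ℝ} (hσ : 1 ≤ σ) (f : ℝ → ℂ) {ξ : ℝ} (hξ : 0 ≤ ξ) (x y : ℝ) :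
    ENNReal.ofReal (if ξ < x then
      |y + (ξ - x - y)| * |ξ - x - y| * (‖f x‖ * ‖f y‖ * ‖f (ξ - x - y)‖) else 0) ≤
    sobWeighted σ f x * ENNReal.ofReal ‖f y‖ * sobWeighted σ f (ξ - x - y) := by
  split_ifs with hx
  · have h0 (z : ℝ) : 0 ≤ jap z := zero_le_one.trans (one_le_jap z)
    have hx0 := h0 x
    have hz0 := h0 (ξ - x - y)
    have h1 : |y + (ξ - x - y)| ≤ jap x ^ σ := by
      refine le_trans ?_ (abs_le_jap_rpow hσ x)
      rw [abs_of_nonpos (by linarith), abs_of_pos (by linarith)]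
      linarith
    have h3 := abs_le_jap_rpow hσ (ξ - x - y)
    rw [sobWeighted, sobWeighted, ← ENNReal.ofReal_mul (by positivity),
      ← ENNReal.ofReal_mul (by positivity)]
    refine ENNReal.ofReal_le_ofReal ?_
    calc _ ≤ jap x ^ σ * jap (ξ - x - y) ^ σ * (‖f x‖ * ‖f y‖ * ‖f (ξ - x - y)‖) := by gcongr
      _ = _ := by ring
  · simp

/-- The Fourier transform of the cubic nonlinearity `C₊(V)` of the gauged
Benjamin–Ono equation is uniformly bounded in frequency by `C‖V‖³_{H^{s+1}}`;
here `ξ₃ = ξ - ξ₁ - ξ₂`. -/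
theorem cubic_nonlinearity_fourier_bounded (s : ℝ) (hs : 0 < s) :
    ∃ C : ℝ, 0 < C ∧ ∀ f : ℝ → ℂ, Measurable f → sobNorm (s + 1) f < ⊤ →
      ∀ ξ : ℝ, 1 < ξ →
        (∫⁻ ξ₁ : ℝ, ∫⁻ ξ₂ : ℝ,
          ENNReal.ofReal (if ξ < ξ₁ then
            |ξ₂ + (ξ - ξ₁ - ξ₂)| * |ξ - ξ₁ - ξ₂| *
              (‖f ξ₁‖ * ‖f ξ₂‖ * ‖f (ξ - ξ₁ - ξ₂)‖)
          else 0))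
        ≤ ENNReal.ofReal C * sobNorm (s + 1) f ^ 3 := by
  set K : ℝ≥0∞ := (∫⁻ x : ℝ, ENNReal.ofReal (jap x ^ (-(2 * (s + 1))))) ^ (1 / 2 : ℝ)
  have hK : K ≠ ⊤ := ENNReal.rpow_ne_top_of_nonneg (by norm_num)
    (lintegral_jap_rpow_lt_top (by linarith)).ne
  refine ⟨K.toReal + 1, by positivity, fun f hf _ ξ hξ => ?_⟩
  have hKC : K ≤ ENNReal.ofReal (K.toReal + 1) :=
    (ENNReal.le_ofReal_iff_toReal_le hK (by positivity)).mpr (by linarith)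
  calc _ ≤ ∫⁻ x, ∫⁻ y, sobWeighted (s + 1) f x * ENNReal.ofReal ‖f y‖ *
          sobWeighted (s + 1) f (ξ - x - y) :=
        lintegral_mono fun x => lintegral_mono fun y =>
          cubic_integrand_le (by linarith) f (by linarith) x y
    _ ≤ (∫⁻ y, ENNReal.ofReal ‖f y‖) * sobNorm (s + 1) f ^ 2 := by
        rw [sobNorm_eq_sobWeighted]
        exact lintegral_triple_convolution_le (measurable_sobWeighted _ hf)
          (v := fun y => ENNReal.ofReal ‖f y‖) (by fun_prop) ξ
    _ ≤ K * sobNorm (s + 1) f * sobNorm (s + 1) f ^ 2 := by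
        gcongr
        exact lintegral_norm_le_sobNorm _ hf
    _ = K * sobNorm (s + 1) f ^ 3 := by ring
    _ ≤ _ := by gcongr
end

section
/- Let s ≥ 0. There exists C > 0 such that the following holds: if g : ℝ → ℂ is locally absolutely continuous with g(0) = 0, its derivative g′ belongs to L²(ℝ), and ∫_ℝ ⟨ξ⟩^{2s} |g(ξ)|² dξ < ∞, then ∫_ℝ ⟨ξ⟩^{2s+2} |g(ξ)/ξ|² dξ ≤ C ( ∫_ℝ ⟨ξ⟩^{2s} |g(ξ)|² dξ + ∫_ℝ |g′(ξ)|² dξ ). (Applied with g = û for u in the weighted space Σ, this shows that the antiderivative F of u, defined by F̂(ξ) = û(ξ)/(iξ), belongs to H^{s+1}(ℝ).) -/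
open MeasureTheory Real
open scoped ENNReal

theorem lintegral_rpow_neg_half :
    ∫⁻ t : ℝ in Set.Ioc 0 1, ENNReal.ofReal (t ^ (-(1 / 2) : ℝ)) = 2 := by
  have hint : IntervalIntegrable (fun t : ℝ => t ^ (-(1 / 2) : ℝ)) volume 0 1 :=
    intervalIntegral.intervalIntegrable_rpow' (by norm_num)
  rw [← ofReal_integral_eq_lintegral_ofReal
    ((intervalIntegrable_iff_integrableOn_Ioc_of_le zero_le_one).1 hint)
    ((ae_restrict_mem measurableSet_Ioc).mono fun t ht => Real.rpow_nonneg ht.1.le _),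
    ← intervalIntegral.integral_of_le zero_le_one, integral_rpow (by norm_num)]
  norm_num

/-- Cauchy–Schwarz on `(0, 1]` with the weight `t ^ (1 / 2)`. -/
theorem lintegral_sq_le_weighted {f : ℝ → ℝ≥0∞} (hf : Measurable f) :
    (∫⁻ t in Set.Ioc (0 : ℝ) 1, f t) ^ 2 ≤
      2 * ∫⁻ t in Set.Ioc (0 : ℝ) 1, ENNReal.ofReal (t ^ (1 / 2 : ℝ)) * f t ^ 2 := by
  have hsq (t : ℝ) (ht : 0 < t) (a : ℝ) :
      ENNReal.ofReal (t ^ a) ^ 2 = ENNReal.ofReal (t ^ (a * 2)) := by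
    rw [← ENNReal.ofReal_pow (by positivity), ← Real.rpow_mul_natCast ht.le]
    norm_num
  have h := ENNReal.lintegral_mul_le_Lp_mul_Lq (volume.restrict (Set.Ioc (0 : ℝ) 1))
    Real.HolderConjugate.two_two
    (f := fun t => ENNReal.ofReal (t ^ (-(1 / 4) : ℝ)))
    (g := fun t => ENNReal.ofReal (t ^ (1 / 4 : ℝ)) * f t)
    (by fun_prop) (by fun_prop)
  have h1 : ∫⁻ t in Set.Ioc (0 : ℝ) 1, f t =
      ∫⁻ t in Set.Ioc (0 : ℝ) 1, ((fun t => ENNReal.ofReal (t ^ (-(1 / 4) : ℝ))) *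
        fun t => ENNReal.ofReal (t ^ (1 / 4 : ℝ)) * f t) t := by
    refine setLIntegral_congr_fun measurableSet_Ioc fun t ht => ?_
    have ht0 : 0 < t := ht.1
    simp only [Pi.mul_apply]
    rw [← mul_assoc, ← ENNReal.ofReal_mul (by positivity), ← Real.rpow_add ht0]
    norm_num
  have h2 : ∫⁻ t in Set.Ioc (0 : ℝ) 1, ENNReal.ofReal (t ^ (-(1 / 4) : ℝ)) ^ (2 : ℝ) = 2 := by
    rw [← lintegral_rpow_neg_half]
    refine setLIntegral_congr_fun measurableSet_Ioc fun t ht => ?_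
    simp only [ENNReal.rpow_two]
    rw [hsq t ht.1]
    norm_num
  have h3 : ∫⁻ t in Set.Ioc (0 : ℝ) 1, (ENNReal.ofReal (t ^ (1 / 4 : ℝ)) * f t) ^ (2 : ℝ) =
      ∫⁻ t in Set.Ioc (0 : ℝ) 1, ENNReal.ofReal (t ^ (1 / 2 : ℝ)) * f t ^ 2 := by
    refine setLIntegral_congr_fun measurableSet_Ioc fun t ht => ?_
    simp only [ENNReal.rpow_two]
    rw [mul_pow, hsq t ht.1]
    norm_num
  rw [h2, h3, ← h1] at h
  calc _ ≤ _ := pow_le_pow_left' h 2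
    _ = _ := by
      rw [mul_pow, ← ENNReal.rpow_two, ← ENNReal.rpow_two, ← ENNReal.rpow_mul,
        ← ENNReal.rpow_mul]
      norm_num

theorem lintegral_comp_const_mul {F : ℝ → ℝ≥0∞} (hF : Measurable F) {t : ℝ} (ht : 0 < t) :
    ∫⁻ x, F (t * x) = ENNReal.ofReal t⁻¹ * ∫⁻ x, F x := by
  rw [← lintegral_map hF (measurable_const_mul t), Real.map_volume_mul_left ht.ne',
    lintegral_smul_measure, abs_of_pos (inv_pos.2 ht), smul_eq_mul]

/-- The averaged form of Hardy's inequality on the whole line. -/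
theorem lintegral_weighted_dilation {F : ℝ → ℝ≥0∞} (hF : Measurable F) :
    ∫⁻ x, ∫⁻ t in Set.Ioc (0 : ℝ) 1, ENNReal.ofReal (t ^ (1 / 2 : ℝ)) * F (t * x) =
      2 * ∫⁻ x, F x := by
  rw [lintegral_lintegral_swap (by fun_prop), ← lintegral_rpow_neg_half,
    ← lintegral_mul_const _ (by fun_prop)]
  refine setLIntegral_congr_fun measurableSet_Ioc fun t ht => ?_
  have ht0 : 0 < t := ht.1
  rw [lintegral_const_mul _ (by fun_prop), lintegral_comp_const_mul hF ht0, ← mul_assoc,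
    ← ENNReal.ofReal_mul (by positivity), ← Real.rpow_neg_one, ← Real.rpow_add ht0]
  norm_num

theorem enorm_div_sq_le_weighted_dilation {g g' : ℝ → ℂ} (hg' : Measurable g')
    (hg : ∀ x : ℝ, g x = ∫ t in (0 : ℝ)..x, g' t) (x : ℝ) :
    ‖g x / (x : ℂ)‖ₑ ^ 2 ≤
      2 * ∫⁻ t in Set.Ioc (0 : ℝ) 1, ENNReal.ofReal (t ^ (1 / 2 : ℝ)) * ‖g' (t * x)‖ₑ ^ 2 := by
  rcases eq_or_ne x 0 with rfl | hx
  · simp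
  have h : g x / (x : ℂ) = ∫ t in Set.Ioc (0 : ℝ) 1, g' (t * x) := by
    rw [← intervalIntegral.integral_of_le zero_le_one,
      intervalIntegral.integral_comp_mul_right g' hx, hg x, zero_mul, one_mul,
      Complex.real_smul, Complex.ofReal_inv, div_eq_inv_mul]
  rw [h]
  exact (pow_le_pow_left' (enorm_integral_le_lintegral_enorm _) 2).trans
    (lintegral_sq_le_weighted (by fun_prop))

theorem jap_pos (ξ : ℝ) : 0 < jap ξ := Real.sqrt_pos.2 (by positivity)

theorem jap_sq (ξ : ℝ) : jap ξ ^ 2 = 1 + ξ ^ 2 := Real.sq_sqrt (by positivity)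

theorem jap_rpow_add_two (s ξ : ℝ) :
    jap ξ ^ (2 * s + 2) = jap ξ ^ (2 * s) * (1 + ξ ^ 2) := by
  rw [Real.rpow_add (jap_pos ξ), Real.rpow_two, jap_sq]

theorem jap_weight_le {s : ℝ} (hs : 0 ≤ s) (ξ : ℝ) (z : ℂ) :
    ENNReal.ofReal (jap ξ ^ (2 * s + 2)) * ‖z / (ξ : ℂ)‖ₑ ^ 2 ≤
      ENNReal.ofReal (2 ^ (s + 1)) * ‖z / (ξ : ℂ)‖ₑ ^ 2 +
        2 * (ENNReal.ofReal (jap ξ ^ (2 * s)) * ‖z‖ₑ ^ 2) := by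
  rcases le_total (ξ ^ 2) 1 with h | h
  · refine le_add_right (mul_le_mul_left (ENNReal.ofReal_le_ofReal ?_) _)
    rw [show 2 * s + 2 = 2 * (s + 1) by ring, Real.rpow_mul (jap_pos ξ).le, Real.rpow_two, jap_sq]
    exact Real.rpow_le_rpow (by positivity) (by linarith) (by linarith)
  · refine le_add_left ?_
    have hp := jap_pos ξ
    rw [← ofReal_norm, ← ofReal_norm, ← ENNReal.ofReal_pow (norm_nonneg _),
      ← ENNReal.ofReal_pow (norm_nonneg _), ← ENNReal.ofReal_mul (by positivity),
      ← ENNReal.ofReal_mul (by positivity), ← ENNReal.ofReal_ofNat 2,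
      ← ENNReal.ofReal_mul (by positivity)]
    refine ENNReal.ofReal_le_ofReal ?_
    rw [jap_rpow_add_two, norm_div, Complex.norm_real, div_pow, Real.norm_eq_abs, sq_abs]
    have hξ : 0 < ξ ^ 2 := by linarith
    rw [← mul_div_assoc, div_le_iff₀ hξ]
    have hA : 0 ≤ jap ξ ^ (2 * s) * ‖z‖ ^ 2 := by positivity
    nlinarith

/-- Hardy-type inequality: if `g` is locally absolutely continuous with
`g(0) = 0` (i.e. `g(ξ) = ∫_0^ξ g'`), `g' ∈ L²`, and `∫ ⟨ξ⟩^{2s} |g|² < ∞`, then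
`∫ ⟨ξ⟩^{2s+2} |g(ξ)/ξ|² dξ ≤ C (∫ ⟨ξ⟩^{2s} |g|² + ∫ |g'|²)`. -/
theorem hardy_type_inequality (s : ℝ) (hs : 0 ≤ s) :
    ∃ C : ℝ, 0 < C ∧ ∀ g g' : ℝ → ℂ, Measurable g' →
      (∀ ξ : ℝ, g ξ = ∫ t in (0 : ℝ)..ξ, g' t) →
      (∫⁻ ξ : ℝ, (‖g' ξ‖₊ : ℝ≥0∞) ^ 2) < ⊤ →
      (∫⁻ ξ : ℝ, ENNReal.ofReal (jap ξ ^ (2 * s)) * (‖g ξ‖₊ : ℝ≥0∞) ^ 2) < ⊤ →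
      (∫⁻ ξ : ℝ, ENNReal.ofReal (jap ξ ^ (2 * s + 2)) * (‖g ξ / (ξ : ℂ)‖₊ : ℝ≥0∞) ^ 2)
        ≤ ENNReal.ofReal C *
          ((∫⁻ ξ : ℝ, ENNReal.ofReal (jap ξ ^ (2 * s)) * (‖g ξ‖₊ : ℝ≥0∞) ^ 2) +
            ∫⁻ ξ : ℝ, (‖g' ξ‖₊ : ℝ≥0∞) ^ 2) := by
  refine ⟨2 ^ (s + 1) * 4 + 2, by positivity, fun g g' hg' hg _ _ => ?_⟩
  simp only [← enorm_eq_nnnorm]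
  set W : ℝ → ℝ≥0∞ := fun ξ =>
    ∫⁻ t in Set.Ioc (0 : ℝ) 1, ENNReal.ofReal (t ^ (1 / 2 : ℝ)) * ‖g' (t * ξ)‖ₑ ^ 2 with hW
  have hWm : Measurable W := by
    refine Measurable.lintegral_prod_right' (f := fun p : ℝ × ℝ =>
      ENNReal.ofReal (p.2 ^ (1 / 2 : ℝ)) * ‖g' (p.2 * p.1)‖ₑ ^ 2) ?_
    fun_prop
  have hWint : ∫⁻ ξ, W ξ = 2 * ∫⁻ ξ, ‖g' ξ‖ₑ ^ 2 :=
    lintegral_weighted_dilation (F := fun x => ‖g' x‖ₑ ^ 2) (by fun_prop)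
  set A := ∫⁻ ξ : ℝ, ENNReal.ofReal (jap ξ ^ (2 * s)) * ‖g ξ‖ₑ ^ 2
  set B := ∫⁻ ξ : ℝ, ‖g' ξ‖ₑ ^ 2
  have h4 : ENNReal.ofReal (2 ^ (s + 1) * 4 + 2) = ENNReal.ofReal (2 ^ (s + 1)) * 4 + 2 := by
    rw [ENNReal.ofReal_add (by positivity) (by norm_num), ENNReal.ofReal_mul (by positivity),
      ENNReal.ofReal_ofNat, ENNReal.ofReal_ofNat]
  calc _ ≤ ∫⁻ ξ : ℝ, (ENNReal.ofReal (2 ^ (s + 1)) * (2 * W ξ) +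
        2 * (ENNReal.ofReal (jap ξ ^ (2 * s)) * ‖g ξ‖ₑ ^ 2)) :=
        lintegral_mono fun ξ => (jap_weight_le hs ξ (g ξ)).trans <| by
          gcongr
          exact enorm_div_sq_le_weighted_dilation hg' hg ξ
    _ = ENNReal.ofReal (2 ^ (s + 1)) * 4 * B + 2 * A := by
        rw [lintegral_add_left (by fun_prop), lintegral_const_mul _ (by fun_prop),
          lintegral_const_mul _ hWm, lintegral_const_mul' _ _ (by norm_num), hWint]
        ring
    _ ≤ (ENNReal.ofReal (2 ^ (s + 1)) * 4 + 2) * B + (ENNReal.ofReal (2 ^ (s + 1)) * 4 + 2) * A := by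
        gcongr
        · exact le_self_add
        · exact le_add_self
    _ = _ := by rw [h4]; ring
end
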